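/- Fix x ∈ ℝⁿ and let y₀ ∈ ℝᵐ, η = 2/(ℓ+μ), and define the gradient ascent iterates y_{k+1} = y_k + η ∇_y f(x, y_k). Given ε₁ > 0 and ε₂ > 0, set A = min{ε₁/ℓ, ε₂/L_H} with L_H = ρ(1+κ)². If N ≥ κ log(‖y₀ − y*(x)‖ / A), then ‖∇P(x) − ∇_x f(x, y_N)‖ ≤ ε₁ and ‖∇²P(x) − H(x, y_N)‖ ≤ ε₂ (operator norm). -/

import Mathlib

noncomputable section

open RealInnerProductSpace

/-- `ℝⁿ` as a Euclidean space. -/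
abbrev En (n : ℕ) := EuclideanSpace ℝ (Fin n)

/-- The point `(x, y)` in the Euclidean (ℓ²) product `ℝⁿ × ℝᵐ`. -/
def pair {n m : ℕ} (x : En n) (y : En m) : WithLp 2 (En n × En m) :=
  (WithLp.equiv 2 (En n × En m)).symm (x, y)

/-- Partial gradient `∇ₓ f(x, y)` with respect to the first variable. -/
def gradx {n m : ℕ} (f : WithLp 2 (En n × En m) → ℝ) (x : En n) (y : En m) : En n :=
  gradient (fun x' => f (pair x' y)) x

/-- Partial gradient `∇_y f(x, y)` with respect to the second variable. -/
def grady {n m : ℕ} (f : WithLp 2 (En n × En m) → ℝ) (x : En n) (y : En m) : En m :=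
  gradient (fun y' => f (pair x y')) y

/-- Second-order partial derivative `∇²ₓₓ f(x, y)`. -/
def Hxx {n m : ℕ} (f : WithLp 2 (En n × En m) → ℝ) (x : En n) (y : En m) : En n →L[ℝ] En n :=
  fderiv ℝ (fun x' => gradx f x' y) x

/-- Second-order partial derivative `∇²ₓ_y f(x, y)`. -/
def Hxy {n m : ℕ} (f : WithLp 2 (En n × En m) → ℝ) (x : En n) (y : En m) : En m →L[ℝ] En n :=
  fderiv ℝ (fun y' => gradx f x y') y

/-- Second-order partial derivative `∇²_yₓ f(x, y)`. -/
def Hyx {n m : ℕ} (f : WithLp 2 (En n × En m) → ℝ) (x : En n) (y : En m) : En n →L[ℝ] En m :=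
  fderiv ℝ (fun x' => grady f x' y) x

/-- Second-order partial derivative `∇²_y_y f(x, y)`. -/
def Hyy {n m : ℕ} (f : WithLp 2 (En n × En m) → ℝ) (x : En n) (y : En m) : En m →L[ℝ] En m :=
  fderiv ℝ (fun y' => grady f x y') y

/-- `H(x,y) = ∇²ₓₓf(x,y) − ∇²ₓ_yf(x,y) (∇²_y_yf(x,y))⁻¹ ∇²_yₓf(x,y)`. -/
def Hmat {n m : ℕ} (f : WithLp 2 (En n × En m) → ℝ) (x : En n) (y : En m) : En n →L[ℝ] En n :=
  Hxx f x y - (Hxy f x y).comp (((Hyy f x y).inverse).comp (Hyx f x y))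

/-- `P(x) = max_y f(x, y)` (as a supremum over `y`). -/
def Pmax {n m : ℕ} (f : WithLp 2 (En n × En m) → ℝ) (x : En n) : ℝ := ⨆ y, f (pair x y)

/-- The Hessian of `P` at `x`, as the derivative of the gradient map. -/
def hessP {n : ℕ} (P : En n → ℝ) (x : En n) : En n →L[ℝ] En n := fderiv ℝ (gradient P) x

open Filter Topology Asymptotics

section General

variable {F : Type*} [NormedAddCommGroup F] [InnerProductSpace ℝ F]

/-- First-order upper bound for a differentiable strongly concave function. -/
theorem StrongConcaveOn.add_sq_le_inner_gradient [CompleteSpace F] {g : F → ℝ} {μ : ℝ}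
    (hg : StrongConcaveOn Set.univ μ g) (hd : Differentiable ℝ g) (y z : F) :
    g z - g y + μ / 2 * ‖y - z‖ ^ 2 ≤ ⟪gradient g y, z - y⟫ := by
  have hline : HasDerivAt (fun t : ℝ => y + t • (z - y)) (z - y) 0 := by
    simpa using ((hasDerivAt_id (0 : ℝ)).smul_const (z - y)).const_add y
  have hfd : HasFDerivAt g (fderiv ℝ g y) (y + (0 : ℝ) • (z - y)) := by
    simpa using (hd y).hasFDerivAt
  have hder := hfd.comp_hasDerivAt (0 : ℝ) hline
  have hslope := (hasDerivAt_iff_tendsto_slope_zero.1 hder).mono_left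
    (nhdsWithin_mono (0 : ℝ) (fun t (ht : t ∈ Set.Ioi (0 : ℝ)) => ht.ne'))
  rw [inner_gradient_left]
  have hlim : Tendsto (fun t : ℝ => g z - g y + (1 - t) * (μ / 2 * ‖y - z‖ ^ 2)) (𝓝[>] 0)
      (𝓝 (g z - g y + (1 - 0) * (μ / 2 * ‖y - z‖ ^ 2))) :=
    ((continuous_const.add ((continuous_const.sub continuous_id).mul
      continuous_const)).tendsto 0).mono_left nhdsWithin_le_nhds
  rw [sub_zero, one_mul] at hlim
  refine le_of_tendsto_of_tendsto hlim hslope ?_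
  filter_upwards [Ioo_mem_nhdsGT (zero_lt_one' ℝ)] with t ht
  have h := hg.2 (Set.mem_univ y) (Set.mem_univ z) (sub_nonneg.2 ht.2.le) ht.1.le (by ring)
  have hpt : (1 - t) • y + t • z = y + t • (z - y) := by module
  rw [hpt] at h
  simp only [smul_eq_mul] at h
  simp only [zero_add, Function.comp_apply, zero_smul, add_zero, smul_eq_mul]
  rw [← div_eq_inv_mul, le_div_iff₀ ht.1]
  linarith

/-- The gradient of a strongly concave function is strongly antitone. -/
theorem StrongConcaveOn.inner_gradient_sub_le [CompleteSpace F] {g : F → ℝ} {μ : ℝ}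
    (hg : StrongConcaveOn Set.univ μ g) (hd : Differentiable ℝ g) (y z : F) :
    ⟪gradient g y - gradient g z, y - z⟫ ≤ -(μ * ‖y - z‖ ^ 2) := by
  have h₁ := hg.add_sq_le_inner_gradient hd y z
  have h₂ := hg.add_sq_le_inner_gradient hd z y
  rw [norm_sub_rev z y] at h₂
  rw [← neg_sub y z, inner_neg_right] at h₁
  rw [inner_sub_left]
  linarith

/-- The derivative of a strongly antitone map is negative definite. -/
theorem HasFDerivAt.inner_apply_self_le {G : F → F} {B : F →L[ℝ] F} {y : F} {μ : ℝ}
    (hB : HasFDerivAt G B y) (hG : ∀ u w, ⟪G u - G w, u - w⟫ ≤ -(μ * ‖u - w‖ ^ 2)) (v : F) :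
    ⟪B v, v⟫ ≤ -(μ * ‖v‖ ^ 2) := by
  have hline : HasDerivAt (fun t : ℝ => y + t • v) v 0 := by
    simpa using ((hasDerivAt_id (0 : ℝ)).smul_const v).const_add y
  have hfd : HasFDerivAt G B (y + (0 : ℝ) • v) := by simpa using hB
  have hslope := (hasDerivAt_iff_tendsto_slope_zero.1
    (hfd.comp_hasDerivAt (0 : ℝ) hline)).mono_left
    (nhdsWithin_mono (0 : ℝ) (fun t (ht : t ∈ Set.Ioi (0 : ℝ)) => ht.ne'))
  refine le_of_tendsto (hslope.inner tendsto_const_nhds) ?_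
  filter_upwards [self_mem_nhdsWithin] with t (ht : 0 < t)
  have h := hG (y + t • v) y
  simp only [add_sub_cancel_left, inner_smul_right, norm_smul, Real.norm_eq_abs,
    _root_.abs_of_pos ht] at h
  simp only [zero_add, Function.comp_apply, zero_smul, add_zero]
  rw [real_inner_smul_left, ← div_eq_inv_mul, div_le_iff₀ ht]
  refine le_of_mul_le_mul_left ?_ ht
  linarith

theorem ContinuousLinearMap.norm_le_of_abs_inner_apply_self_le {T : F →L[ℝ] F}
    (hT : (T : F →ₗ[ℝ] F).IsSymmetric) {r : ℝ} (hr : 0 ≤ r)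
    (h : ∀ v, |⟪T v, v⟫| ≤ r * ‖v‖ ^ 2) : ‖T‖ ≤ r := by
  rw [ContinuousLinearMap.norm_eq_iSup_rayleighQuotient T hT]
  refine ciSup_le fun v => ?_
  rw [ContinuousLinearMap.rayleighQuotient, ContinuousLinearMap.reApplyInnerSelf_apply, abs_div,
    abs_of_nonneg (sq_nonneg ‖v‖)]
  exact div_le_of_le_mul₀ (sq_nonneg _) hr (by simpa using h v)

theorem le_norm_apply_of_inner_apply_self_le {B : F →L[ℝ] F} {μ : ℝ}
    (hB : ∀ v, ⟪B v, v⟫ ≤ -(μ * ‖v‖ ^ 2)) (v : F) : μ * ‖v‖ ≤ ‖B v‖ := by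
  rcases (norm_nonneg v).eq_or_lt with hv | hv
  · rw [← hv, mul_zero]; exact norm_nonneg _
  · have h₁ := neg_le_of_abs_le (abs_real_inner_le_norm (B v) v)
    have h₂ := hB v
    refine le_of_mul_le_mul_right ?_ hv
    nlinarith

theorem isInvertible_of_inner_apply_self_le [FiniteDimensional ℝ F] {B : F →L[ℝ] F} {μ : ℝ}
    (hμ : 0 < μ) (hB : ∀ v, ⟪B v, v⟫ ≤ -(μ * ‖v‖ ^ 2)) : B.IsInvertible := by
  have hinj : Function.Injective (B : F →ₗ[ℝ] F) := by
    rw [injective_iff_map_eq_zero]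
    intro v hv
    have h := le_norm_apply_of_inner_apply_self_le hB v
    rw [show B v = 0 from hv, norm_zero] at h
    exact norm_le_zero_iff.1 (nonpos_of_mul_nonpos_right h hμ)
  exact ⟨(LinearEquiv.ofInjectiveEndo (B : F →ₗ[ℝ] F) hinj).toContinuousLinearEquiv, by ext; rfl⟩

theorem norm_inverse_le_of_inner_apply_self_le [FiniteDimensional ℝ F] {B : F →L[ℝ] F} {μ : ℝ}
    (hμ : 0 < μ) (hB : ∀ v, ⟪B v, v⟫ ≤ -(μ * ‖v‖ ^ 2)) : ‖B.inverse‖ ≤ μ⁻¹ := by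
  refine ContinuousLinearMap.opNorm_le_bound _ (inv_nonneg.2 hμ.le) fun w => ?_
  have h := le_norm_apply_of_inner_apply_self_le hB (B.inverse w)
  rw [(isInvertible_of_inner_apply_self_le hμ hB).self_apply_inverse] at h
  rwa [← div_eq_inv_mul, le_div_iff₀' hμ]

/-- A gradient step with step size `2 / (ℓ + μ)` is a contraction on operators with spectrum in
`[-ℓ, -μ]`. -/
theorem norm_id_add_smul_le {B : F →L[ℝ] F} (hsymm : (B : F →ₗ[ℝ] F).IsSymmetric) {ℓ μ : ℝ}
    (hμ : 0 < μ) (hμℓ : μ < ℓ) (hB : ∀ v, ⟪B v, v⟫ ≤ -(μ * ‖v‖ ^ 2)) (hℓ : ‖B‖ ≤ ℓ) :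
    ‖ContinuousLinearMap.id ℝ F + (2 / (ℓ + μ)) • B‖ ≤ (ℓ - μ) / (ℓ + μ) := by
  have hpos : 0 < ℓ + μ := by linarith
  refine ContinuousLinearMap.norm_le_of_abs_inner_apply_self_le ?_
    (div_nonneg (by linarith) hpos.le) fun v => ?_
  · intro u w
    have h : ⟪B u, w⟫ = ⟪u, B w⟫ := hsymm u w
    simp [inner_add_left, inner_add_right, real_inner_smul_left, real_inner_smul_right, h]
  · have h₁ := hB v
    have h₂ : -(ℓ * ‖v‖ ^ 2) ≤ ⟪B v, v⟫ := by
      have := neg_le_of_abs_le (abs_real_inner_le_norm (B v) v)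
      have := B.le_of_opNorm_le hℓ v
      nlinarith [norm_nonneg v]
    have h₃ : ⟪(ContinuousLinearMap.id ℝ F + (2 / (ℓ + μ)) • B) v, v⟫
        = ((ℓ + μ) * ‖v‖ ^ 2 + 2 * ⟪B v, v⟫) / (ℓ + μ) := by
      simp only [add_apply, ContinuousLinearMap.id_apply,
        smul_apply, inner_add_left, real_inner_smul_left,
        real_inner_self_eq_norm_sq]
      field_simp
    rw [h₃, abs_div, abs_of_pos hpos, div_mul_eq_mul_div]
    gcongr
    rw [abs_le]
    constructor <;> linarith

/-- The inverse Riesz isomorphism of a real Hilbert space as a continuous linear map. -/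
def rieszSymm (F : Type*) [NormedAddCommGroup F] [InnerProductSpace ℝ F] [CompleteSpace F] :
    StrongDual ℝ F →L[ℝ] F where
  toFun := (InnerProductSpace.toDual ℝ F).symm
  map_add' := map_add _
  map_smul' c φ := by simp
  cont := (InnerProductSpace.toDual ℝ F).symm.continuous

theorem ContDiff.hasFDerivAt_gradient [CompleteSpace F] {f : F → ℝ} (hf : ContDiff ℝ 2 f) (p : F) :
    HasFDerivAt (gradient f) (rieszSymm F ∘L fderiv ℝ (fderiv ℝ f) p) p :=
  (rieszSymm F).hasFDerivAt.comp p
    ((hf.fderiv_right (m := 1) (by norm_num)).differentiable (by norm_num) p).hasFDerivAt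

/-- The derivative of the gradient of a `C²` function is symmetric. -/
theorem ContDiff.inner_fderiv_gradient_comm [CompleteSpace F] {f : F → ℝ} (hf : ContDiff ℝ 2 f)
    (p u w : F) : ⟪fderiv ℝ (gradient f) p u, w⟫ = ⟪u, fderiv ℝ (gradient f) p w⟫ := by
  have key : ∀ u w : F, ⟪fderiv ℝ (gradient f) p u, w⟫ = fderiv ℝ (fderiv ℝ f) p u w := by
    intro u w
    rw [(hf.hasFDerivAt_gradient p).fderiv]
    exact InnerProductSpace.toDual_symm_apply
  rw [real_inner_comm _ u, key, key]
  exact (hf.contDiffAt.isSymmSndFDerivAt (by simp)) u w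

end General

section Implicit

variable {X Y E : Type*} [NormedAddCommGroup X] [NormedSpace ℝ X] [NormedAddCommGroup Y]
  [NormedSpace ℝ Y] [NormedAddCommGroup E] [NormedSpace ℝ E]

/-- Implicit differentiation of a solution map which is already known to be Lipschitz at `x`. -/
theorem hasFDerivAt_of_implicit {G : E → Y} {D : E →L[ℝ] Y} {S : X →L[ℝ] E} {T : Y →L[ℝ] E}
    {u : X → Y} {x : X} (hG : HasFDerivAt G D (S x + T (u x)))
    (hu : ∀ x', G (S x' + T (u x')) = 0) (hlip : (fun x' => u x' - u x) =O[𝓝 x] fun x' => x' - x)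
    (hinv : (D ∘L T).IsInvertible) :
    HasFDerivAt u (-((D ∘L T).inverse ∘L (D ∘L S))) x := by
  have hdiff : ∀ x', S x' + T (u x') - (S x + T (u x)) = S (x' - x) + T (u x' - u x) := by
    intro x'; simp only [map_sub]; abel
  have hO : (fun x' => S x' + T (u x') - (S x + T (u x))) =O[𝓝 x] fun x' => x' - x := by
    simp only [hdiff]
    exact (S.isBigO_comp _ _).add ((T.isBigO_comp _ _).trans hlip)
  have htend : Tendsto (fun x' => S x' + T (u x')) (𝓝 x) (𝓝 (S x + T (u x))) := by
    rw [tendsto_iff_norm_sub_tendsto_zero]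
    refine (hO.trans_tendsto ?_).norm.trans (by simp)
    simpa using (continuous_id.sub continuous_const).tendsto (x := x) (f := fun x' => x' - x)
  have ho := ((hasFDerivAt_iff_isLittleO.1 hG).comp_tendsto htend).trans_isBigO hO
  rw [hasFDerivAt_iff_isLittleO]
  have ho' := (((D ∘L T).inverse.isBigO_comp _ _).trans_isLittleO ho).neg_left
  refine ho'.congr_left fun x' => ?_
  have h := hinv.inverse_apply_self (u x' - u x)
  simp only [Function.comp_apply, hu, hdiff, map_add, sub_zero, zero_sub, map_neg, neg_neg]
  simp only [ContinuousLinearMap.comp_apply] at h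
  rw [h]
  simp only [neg_apply, ContinuousLinearMap.comp_apply]
  abel

/-- Perturbation bound for `C - A B⁻¹ A'`. -/
theorem norm_schur_sub_le {C₁ C₂ : X →L[ℝ] X} {A₁ A₂ : Y →L[ℝ] X} {B₁ B₂ : Y →L[ℝ] Y}
    {A₁' A₂' : X →L[ℝ] Y} {ℓ μ δ : ℝ} (hμ : 0 < μ) (hℓ : 0 ≤ ℓ) (hδ : 0 ≤ δ)
    (hB₁ : B₁.IsInvertible) (hB₂ : B₂.IsInvertible)
    (hi₁ : ‖B₁.inverse‖ ≤ μ⁻¹) (hi₂ : ‖B₂.inverse‖ ≤ μ⁻¹) (hA₂ : ‖A₂‖ ≤ ℓ) (hA₁' : ‖A₁'‖ ≤ ℓ)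
    (hC : ‖C₁ - C₂‖ ≤ δ) (hA : ‖A₁ - A₂‖ ≤ δ) (hA' : ‖A₁' - A₂'‖ ≤ δ) (hB : ‖B₁ - B₂‖ ≤ δ) :
    ‖(C₁ - A₁ ∘L (B₁.inverse ∘L A₁')) - (C₂ - A₂ ∘L (B₂.inverse ∘L A₂'))‖
      ≤ (1 + ℓ / μ) ^ 2 * δ := by
  have hsplit : (C₁ - A₁ ∘L (B₁.inverse ∘L A₁')) - (C₂ - A₂ ∘L (B₂.inverse ∘L A₂'))
      = (C₁ - C₂) - (A₁ - A₂) ∘L (B₁.inverse ∘L A₁')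
        + A₂ ∘L (B₂.inverse ∘L ((B₁ - B₂) ∘L (B₁.inverse ∘L A₁')))
        - A₂ ∘L (B₂.inverse ∘L (A₁' - A₂')) := by
    ext1 v
    have h₁ := hB₁.self_apply_inverse (A₁' v)
    have h₂ := hB₂.inverse_apply_self (B₁.inverse (A₁' v))
    simp only [add_apply, sub_apply,
      ContinuousLinearMap.comp_apply, map_sub, h₁, h₂]
    abel
  have hcomp : ‖B₁.inverse ∘L A₁'‖ ≤ μ⁻¹ * ℓ :=
    (ContinuousLinearMap.opNorm_comp_le _ _).trans (by gcongr)
  have t₁ : ‖(A₁ - A₂) ∘L (B₁.inverse ∘L A₁')‖ ≤ δ * (μ⁻¹ * ℓ) :=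
    (ContinuousLinearMap.opNorm_comp_le _ _).trans (by gcongr)
  have t₂ : ‖A₂ ∘L (B₂.inverse ∘L ((B₁ - B₂) ∘L (B₁.inverse ∘L A₁')))‖
      ≤ ℓ * (μ⁻¹ * (δ * (μ⁻¹ * ℓ))) := by
    refine (ContinuousLinearMap.opNorm_comp_le _ _).trans ?_
    gcongr
    refine (ContinuousLinearMap.opNorm_comp_le _ _).trans ?_
    gcongr
    exact (ContinuousLinearMap.opNorm_comp_le _ _).trans (by gcongr)
  have t₃ : ‖A₂ ∘L (B₂.inverse ∘L (A₁' - A₂'))‖ ≤ ℓ * (μ⁻¹ * δ) := by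
    refine (ContinuousLinearMap.opNorm_comp_le _ _).trans ?_
    gcongr
    exact (ContinuousLinearMap.opNorm_comp_le _ _).trans (by gcongr)
  rw [hsplit]
  calc _ ≤ δ + δ * (μ⁻¹ * ℓ) + ℓ * (μ⁻¹ * (δ * (μ⁻¹ * ℓ))) + ℓ * (μ⁻¹ * δ) :=
        (norm_sub_le _ _).trans (add_le_add ((norm_add_le _ _).trans
          (add_le_add ((norm_sub_le _ _).trans (add_le_add hC t₁)) t₂)) t₃)
    _ = (1 + ℓ / μ) ^ 2 * δ := by rw [div_eq_mul_inv]; ring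

end Implicit

/-- A linearly convergent sequence with rate `(ℓ - μ) / (ℓ + μ)` reaches accuracy `A` after
`(ℓ / μ) log (d / A)` steps. -/
theorem pow_mul_le_of_mul_log_le {ℓ μ d A : ℝ} {N : ℕ} (hμ : 0 < μ) (hμℓ : μ < ℓ) (hd : 0 ≤ d)
    (hA : 0 < A) (hN : ℓ / μ * Real.log (d / A) ≤ N) : ((ℓ - μ) / (ℓ + μ)) ^ N * d ≤ A := by
  rcases hd.eq_or_lt with rfl | hd
  · simpa using hA.le
  have hℓ : 0 < ℓ := hμ.trans hμℓ
  have hrate : (ℓ - μ) / (ℓ + μ) ≤ Real.exp (-(μ / ℓ)) := by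
    have h := Real.add_one_le_exp (-(μ / ℓ))
    refine le_trans ?_ h
    rw [div_le_iff₀ (by linarith)]
    have h₁ : (-(μ / ℓ) + 1) * (ℓ + μ) - (ℓ - μ) = μ * (ℓ - μ) / ℓ := by field_simp; ring
    have h₂ : 0 ≤ μ * (ℓ - μ) / ℓ := div_nonneg (mul_nonneg hμ.le (by linarith)) hℓ.le
    linarith
  have hlog : Real.log (d / A) ≤ N * (μ / ℓ) := by
    calc Real.log (d / A) = ℓ / μ * Real.log (d / A) * (μ / ℓ) := by field_simp
      _ ≤ N * (μ / ℓ) := by gcongr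
  calc ((ℓ - μ) / (ℓ + μ)) ^ N * d ≤ Real.exp (-(μ / ℓ)) ^ N * d := by
        gcongr
    _ = Real.exp (-(N * (μ / ℓ))) * d := by rw [← Real.exp_nat_mul]; ring_nf
    _ ≤ Real.exp (-Real.log (d / A)) * d := by gcongr
    _ = A := by rw [Real.exp_neg, Real.exp_log (div_pos hd hA)]; field_simp

section Blocks

variable {n m : ℕ} {f : WithLp 2 (En n × En m) → ℝ} {ℓ μ : ℝ}

/-- The embedding `x ↦ (x, 0)`. -/
def pairInl (n m : ℕ) : En n →L[ℝ] WithLp 2 (En n × En m) :=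
  ((WithLp.prodContinuousLinearEquiv 2 ℝ (En n) (En m)).symm :
    En n × En m →L[ℝ] WithLp 2 (En n × En m)) ∘L ContinuousLinearMap.inl ℝ (En n) (En m)

/-- The embedding `y ↦ (0, y)`. -/
def pairInr (n m : ℕ) : En m →L[ℝ] WithLp 2 (En n × En m) :=
  ((WithLp.prodContinuousLinearEquiv 2 ℝ (En n) (En m)).symm :
    En n × En m →L[ℝ] WithLp 2 (En n × En m)) ∘L ContinuousLinearMap.inr ℝ (En n) (En m)

/-- The projection `(x, y) ↦ x`. -/
def pairFst (n m : ℕ) : WithLp 2 (En n × En m) →L[ℝ] En n := WithLp.fstL 2 ℝ (En n) (En m)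

/-- The projection `(x, y) ↦ y`. -/
def pairSnd (n m : ℕ) : WithLp 2 (En n × En m) →L[ℝ] En m := WithLp.sndL 2 ℝ (En n) (En m)

theorem pair_eq_add (x : En n) (y : En m) : pair x y = pairInl n m x + pairInr n m y := by
  apply (WithLp.equiv 2 (En n × En m)).injective
  simp [pair, pairInl, pairInr]

theorem norm_pairInl_apply (x : En n) : ‖pairInl n m x‖ = ‖x‖ := WithLp.norm_toLp_fst 2 _ _ x

theorem norm_pairInr_apply (y : En m) : ‖pairInr n m y‖ = ‖y‖ := WithLp.norm_toLp_snd 2 _ _ y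

theorem norm_pairFst_apply_le (p : WithLp 2 (En n × En m)) : ‖pairFst n m p‖ ≤ ‖p‖ :=
  WithLp.norm_fst_le _ p

theorem norm_pairSnd_apply_le (p : WithLp 2 (En n × En m)) : ‖pairSnd n m p‖ ≤ ‖p‖ :=
  WithLp.norm_snd_le _ p

theorem inner_pairInl (p : WithLp 2 (En n × En m)) (v : En n) :
    ⟪p, pairInl n m v⟫ = ⟪pairFst n m p, v⟫ := by
  rw [WithLp.prod_inner_apply]
  simp [pairInl, pairFst]

theorem inner_pairInr (p : WithLp 2 (En n × En m)) (v : En m) :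
    ⟪p, pairInr n m v⟫ = ⟪pairSnd n m p, v⟫ := by
  rw [WithLp.prod_inner_apply]
  simp [pairInr, pairSnd]

theorem pair_sub_pair_left (x x' : En n) (y : En m) :
    pair x y - pair x' y = pairInl n m (x - x') := by
  simp only [pair_eq_add, map_sub]; abel

theorem pair_sub_pair_right (x : En n) (y y' : En m) :
    pair x y - pair x y' = pairInr n m (y - y') := by
  simp only [pair_eq_add, map_sub]; abel

theorem hasFDerivAt_pair_left (x : En n) (y : En m) :
    HasFDerivAt (fun x' => pair x' y) (pairInl n m) x := by
  simp only [pair_eq_add]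
  exact (pairInl n m).hasFDerivAt.add_const _

theorem hasFDerivAt_pair_right (x : En n) (y : En m) :
    HasFDerivAt (fun y' => pair x y') (pairInr n m) y := by
  simp only [pair_eq_add]
  exact (pairInr n m).hasFDerivAt.const_add _

theorem gradx_eq (hf : Differentiable ℝ f) (x : En n) (y : En m) :
    gradx f x y = pairFst n m (gradient f (pair x y)) := by
  refine HasGradientAt.gradient (hasGradientAt_iff_hasFDerivAt.2 ?_)
  refine ((hf (pair x y)).hasFDerivAt.comp x (hasFDerivAt_pair_left x y)).congr_fderiv ?_
  ext1 v
  rw [InnerProductSpace.toDual_apply_apply, ← inner_pairInl, inner_gradient_left]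
  rfl

theorem grady_eq (hf : Differentiable ℝ f) (x : En n) (y : En m) :
    grady f x y = pairSnd n m (gradient f (pair x y)) := by
  refine HasGradientAt.gradient (hasGradientAt_iff_hasFDerivAt.2 ?_)
  refine ((hf (pair x y)).hasFDerivAt.comp y (hasFDerivAt_pair_right x y)).congr_fderiv ?_
  ext1 v
  rw [InnerProductSpace.toDual_apply_apply, ← inner_pairInr, inner_gradient_left]
  rfl

theorem ContDiff.hasFDerivAt_fderiv_gradient (hf : ContDiff ℝ 2 f) (p : WithLp 2 (En n × En m)) :
    HasFDerivAt (gradient f) (fderiv ℝ (gradient f) p) p :=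
  (hf.hasFDerivAt_gradient p).differentiableAt.hasFDerivAt

theorem hasFDerivAt_grady_right (hf : ContDiff ℝ 2 f) (x : En n) (y : En m) :
    HasFDerivAt (fun y' => grady f x y')
      (pairSnd n m ∘L (fderiv ℝ (gradient f) (pair x y) ∘L pairInr n m)) y := by
  simp only [grady_eq (hf.differentiable (by norm_num))]
  exact (pairSnd n m).hasFDerivAt.comp y
    ((hf.hasFDerivAt_fderiv_gradient _).comp y (hasFDerivAt_pair_right x y))

theorem Hyy_eq (hf : ContDiff ℝ 2 f) (x : En n) (y : En m) :
    Hyy f x y = pairSnd n m ∘L (fderiv ℝ (gradient f) (pair x y) ∘L pairInr n m) :=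
  (hasFDerivAt_grady_right hf x y).fderiv

theorem Hyx_eq (hf : ContDiff ℝ 2 f) (x : En n) (y : En m) :
    Hyx f x y = pairSnd n m ∘L (fderiv ℝ (gradient f) (pair x y) ∘L pairInl n m) := by
  unfold Hyx
  simp only [grady_eq (hf.differentiable (by norm_num))]
  exact ((pairSnd n m).hasFDerivAt.comp x
    ((hf.hasFDerivAt_fderiv_gradient _).comp x (hasFDerivAt_pair_left x y))).fderiv

theorem Hxx_eq (hf : ContDiff ℝ 2 f) (x : En n) (y : En m) :
    Hxx f x y = pairFst n m ∘L (fderiv ℝ (gradient f) (pair x y) ∘L pairInl n m) := by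
  unfold Hxx
  simp only [gradx_eq (hf.differentiable (by norm_num))]
  exact ((pairFst n m).hasFDerivAt.comp x
    ((hf.hasFDerivAt_fderiv_gradient _).comp x (hasFDerivAt_pair_left x y))).fderiv

theorem Hxy_eq (hf : ContDiff ℝ 2 f) (x : En n) (y : En m) :
    Hxy f x y = pairFst n m ∘L (fderiv ℝ (gradient f) (pair x y) ∘L pairInr n m) := by
  unfold Hxy
  simp only [gradx_eq (hf.differentiable (by norm_num))]
  exact ((pairFst n m).hasFDerivAt.comp y
    ((hf.hasFDerivAt_fderiv_gradient _).comp y (hasFDerivAt_pair_right x y))).fderiv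

theorem norm_fderiv_gradient_le (hℓ : 0 ≤ ℓ)
    (hlip : ∀ p q : WithLp 2 (En n × En m), ‖gradient f p - gradient f q‖ ≤ ℓ * ‖p - q‖)
    (p : WithLp 2 (En n × En m)) : ‖fderiv ℝ (gradient f) p‖ ≤ ℓ :=
  norm_fderiv_le_of_lip' ℝ hℓ (Filter.Eventually.of_forall fun q => hlip q p)

theorem norm_Hxy_le (hf : ContDiff ℝ 2 f) (hℓ : 0 ≤ ℓ)
    (hlip : ∀ p q : WithLp 2 (En n × En m), ‖gradient f p - gradient f q‖ ≤ ℓ * ‖p - q‖)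
    (x : En n) (y : En m) : ‖Hxy f x y‖ ≤ ℓ := by
  rw [Hxy_eq hf]
  refine ContinuousLinearMap.opNorm_le_bound _ hℓ fun v => ?_
  refine (norm_pairFst_apply_le _).trans ?_
  rw [← norm_pairInr_apply (n := n) v]
  exact ContinuousLinearMap.le_of_opNorm_le _ (norm_fderiv_gradient_le hℓ hlip _) _

theorem norm_Hyx_le (hf : ContDiff ℝ 2 f) (hℓ : 0 ≤ ℓ)
    (hlip : ∀ p q : WithLp 2 (En n × En m), ‖gradient f p - gradient f q‖ ≤ ℓ * ‖p - q‖)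
    (x : En n) (y : En m) : ‖Hyx f x y‖ ≤ ℓ := by
  rw [Hyx_eq hf]
  refine ContinuousLinearMap.opNorm_le_bound _ hℓ fun v => ?_
  refine (norm_pairSnd_apply_le _).trans ?_
  rw [← norm_pairInl_apply (m := m) v]
  exact ContinuousLinearMap.le_of_opNorm_le _ (norm_fderiv_gradient_le hℓ hlip _) _

theorem norm_Hyy_le (hf : ContDiff ℝ 2 f) (hℓ : 0 ≤ ℓ)
    (hlip : ∀ p q : WithLp 2 (En n × En m), ‖gradient f p - gradient f q‖ ≤ ℓ * ‖p - q‖)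
    (x : En n) (y : En m) : ‖Hyy f x y‖ ≤ ℓ := by
  rw [Hyy_eq hf]
  refine ContinuousLinearMap.opNorm_le_bound _ hℓ fun v => ?_
  refine (norm_pairSnd_apply_le _).trans ?_
  rw [← norm_pairInr_apply (n := n) v]
  exact ContinuousLinearMap.le_of_opNorm_le _ (norm_fderiv_gradient_le hℓ hlip _) _

theorem isSymmetric_Hyy (hf : ContDiff ℝ 2 f) (x : En n) (y : En m) :
    (Hyy f x y : En m →ₗ[ℝ] En m).IsSymmetric := by
  intro u w
  rw [Hyy_eq hf]
  have h := hf.inner_fderiv_gradient_comm (pair x y) (pairInr n m u) (pairInr n m w)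
  rwa [inner_pairInr, real_inner_comm _ (pairInr n m u), inner_pairInr, real_inner_comm u] at h

theorem inner_grady_sub_le (hf : ContDiff ℝ 2 f)
    (hconc : ∀ x : En n, StrongConcaveOn Set.univ μ (fun y => f (pair x y)))
    (x : En n) (y z : En m) :
    ⟪grady f x y - grady f x z, y - z⟫ ≤ -(μ * ‖y - z‖ ^ 2) :=
  (hconc x).inner_gradient_sub_le (fun y' => ((hf.differentiable (by norm_num)) _).comp y'
    (hasFDerivAt_pair_right x y').differentiableAt) y z

theorem inner_Hyy_apply_self_le (hf : ContDiff ℝ 2 f)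
    (hconc : ∀ x : En n, StrongConcaveOn Set.univ μ (fun y => f (pair x y)))
    (x : En n) (y v : En m) : ⟪Hyy f x y v, v⟫ ≤ -(μ * ‖v‖ ^ 2) := by
  rw [Hyy_eq hf]
  exact (hasFDerivAt_grady_right hf x y).inner_apply_self_le (inner_grady_sub_le hf hconc x) v

/-- One step of gradient ascent with step size `2 / (ℓ + μ)` is a contraction. -/
theorem norm_gradient_step_sub_le (hf : ContDiff ℝ 2 f) (hμ : 0 < μ) (hμℓ : μ < ℓ)
    (hlip : ∀ p q : WithLp 2 (En n × En m), ‖gradient f p - gradient f q‖ ≤ ℓ * ‖p - q‖)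
    (hconc : ∀ x : En n, StrongConcaveOn Set.univ μ (fun y => f (pair x y)))
    (x : En n) (y z : En m) :
    ‖(y + (2 / (ℓ + μ)) • grady f x y) - (z + (2 / (ℓ + μ)) • grady f x z)‖
      ≤ (ℓ - μ) / (ℓ + μ) * ‖y - z‖ := by
  refine convex_univ.norm_image_sub_le_of_norm_hasFDerivWithin_le
    (f := fun y => y + (2 / (ℓ + μ)) • grady f x y)
    (f' := fun y => ContinuousLinearMap.id ℝ (En m) + (2 / (ℓ + μ)) • Hyy f x y)
    (fun w _ => ?_) (fun w _ => ?_) (Set.mem_univ z) (Set.mem_univ y)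
  · rw [Hyy_eq hf]
    exact ((hasFDerivAt_id w).add
      ((hasFDerivAt_grady_right hf x w).const_smul (2 / (ℓ + μ)))).hasFDerivWithinAt
  · exact norm_id_add_smul_le (isSymmetric_Hyy hf x w) hμ hμℓ
      (inner_Hyy_apply_self_le hf hconc x w) (norm_Hyy_le hf (hμ.trans hμℓ).le hlip x w)

theorem grady_eq_zero_of_isMax {x : En n} {z : En m} (h : ∀ y, f (pair x y) ≤ f (pair x z)) :
    grady f x z = 0 := by
  have hmax : IsLocalMax (fun y => f (pair x y)) z := Filter.Eventually.of_forall h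
  rw [grady, gradient, hmax.fderiv_eq_zero, map_zero]

/-- The inner maximizer is `ℓ / μ`-Lipschitz. -/
theorem norm_argmax_sub_le (hf : ContDiff ℝ 2 f) (hμ : 0 < μ)
    (hlip : ∀ p q : WithLp 2 (En n × En m), ‖gradient f p - gradient f q‖ ≤ ℓ * ‖p - q‖)
    (hconc : ∀ x : En n, StrongConcaveOn Set.univ μ (fun y => f (pair x y)))
    {ystar : En n → En m} (hstar : ∀ (x : En n) (y : En m), f (pair x y) ≤ f (pair x (ystar x)))
    (x x' : En n) : ‖ystar x' - ystar x‖ ≤ ℓ / μ * ‖x' - x‖ := by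
  have h₁ := inner_grady_sub_le hf hconc x' (ystar x') (ystar x)
  have hz : grady f x' (ystar x') = grady f x (ystar x) := by
    rw [grady_eq_zero_of_isMax (hstar x'), grady_eq_zero_of_isMax (hstar x)]
  have h₂ : ‖grady f x' (ystar x') - grady f x' (ystar x)‖ ≤ ℓ * ‖x' - x‖ := by
    rw [hz, grady_eq (hf.differentiable (by norm_num)), grady_eq (hf.differentiable (by norm_num)),
      ← map_sub]
    refine (norm_pairSnd_apply_le _).trans ((hlip _ _).trans_eq ?_)
    rw [pair_sub_pair_left, norm_pairInl_apply, norm_sub_rev]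
  have h₃ := neg_le_of_abs_le (abs_real_inner_le_norm
    (grady f x' (ystar x') - grady f x' (ystar x)) (ystar x' - ystar x))
  rw [div_mul_eq_mul_div, le_div_iff₀ hμ]
  rcases (norm_nonneg (ystar x' - ystar x)).eq_or_lt with h | h
  · rw [← h, zero_mul]; exact (norm_nonneg _).trans h₂
  · refine le_of_mul_le_mul_right ?_ h
    nlinarith

theorem hasFDerivAt_argmax (hf : ContDiff ℝ 2 f) (hμ : 0 < μ)
    (hlip : ∀ p q : WithLp 2 (En n × En m), ‖gradient f p - gradient f q‖ ≤ ℓ * ‖p - q‖)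
    (hconc : ∀ x : En n, StrongConcaveOn Set.univ μ (fun y => f (pair x y)))
    {ystar : En n → En m} (hstar : ∀ (x : En n) (y : En m), f (pair x y) ≤ f (pair x (ystar x)))
    (x : En n) :
    HasFDerivAt ystar (-((Hyy f x (ystar x)).inverse ∘L Hyx f x (ystar x))) x := by
  have hinv : (Hyy f x (ystar x)).IsInvertible :=
    isInvertible_of_inner_apply_self_le hμ (inner_Hyy_apply_self_le hf hconc x (ystar x))
  rw [Hyy_eq hf] at hinv ⊢
  rw [Hyx_eq hf]
  refine hasFDerivAt_of_implicit (G := fun p => pairSnd n m (gradient f p))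
    (D := pairSnd n m ∘L fderiv ℝ (gradient f) (pair x (ystar x))) ?_ (fun x' => ?_) ?_ hinv
  · rw [← pair_eq_add]
    exact (pairSnd n m).hasFDerivAt.comp _ (hf.hasFDerivAt_fderiv_gradient _)
  · rw [← pair_eq_add, ← grady_eq (hf.differentiable (by norm_num))]
    exact grady_eq_zero_of_isMax (hstar x')
  · exact Asymptotics.IsBigO.of_bound (ℓ / μ) (Filter.Eventually.of_forall fun x' =>
      norm_argmax_sub_le hf hμ hlip hconc hstar x x')

theorem hasFDerivAt_pair_argmax {ystar : En n → En m} {x : En n} {Y : En n →L[ℝ] En m}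
    (hY : HasFDerivAt ystar Y x) :
    HasFDerivAt (fun x' => pair x' (ystar x')) (pairInl n m + pairInr n m ∘L Y) x := by
  simp only [pair_eq_add]
  exact (pairInl n m).hasFDerivAt.add ((pairInr n m).hasFDerivAt.comp x hY)

theorem Pmax_eq {ystar : En n → En m}
    (hstar : ∀ (x : En n) (y : En m), f (pair x y) ≤ f (pair x (ystar x))) :
    Pmax f = fun x => f (pair x (ystar x)) :=
  funext fun x => le_antisymm (ciSup_le (hstar x))
    (le_ciSup (f := fun y => f (pair x y)) ⟨_, Set.forall_mem_range.2 (hstar x)⟩ (ystar x))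

/-- Danskin's formula `∇P(x) = ∇ₓ f(x, y*(x))`. -/
theorem gradient_Pmax (hf : Differentiable ℝ f) {ystar : En n → En m} (hd : Differentiable ℝ ystar)
    (hstar : ∀ (x : En n) (y : En m), f (pair x y) ≤ f (pair x (ystar x))) (x : En n) :
    gradient (Pmax f) x = gradx f x (ystar x) := by
  rw [Pmax_eq hstar]
  refine HasGradientAt.gradient (hasGradientAt_iff_hasFDerivAt.2 ?_)
  refine ((hf _).hasFDerivAt.comp x
    (hasFDerivAt_pair_argmax (hd x).hasFDerivAt)).congr_fderiv ?_
  ext1 v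
  have hz := grady_eq_zero_of_isMax (hstar x)
  rw [grady_eq hf] at hz
  rw [InnerProductSpace.toDual_apply_apply, gradx_eq hf, ContinuousLinearMap.comp_apply,
    ← inner_gradient_left, add_apply, inner_add_right, inner_pairInl,
    ContinuousLinearMap.comp_apply, inner_pairInr, hz, inner_zero_left, add_zero]

/-- The Hessian of `P` at `x` is `H(x, y*(x))`. -/
theorem hessP_Pmax (hf : ContDiff ℝ 2 f) (hμ : 0 < μ)
    (hlip : ∀ p q : WithLp 2 (En n × En m), ‖gradient f p - gradient f q‖ ≤ ℓ * ‖p - q‖)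
    (hconc : ∀ x : En n, StrongConcaveOn Set.univ μ (fun y => f (pair x y)))
    {ystar : En n → En m} (hstar : ∀ (x : En n) (y : En m), f (pair x y) ≤ f (pair x (ystar x)))
    (x : En n) : hessP (Pmax f) x = Hmat f x (ystar x) := by
  have hY := hasFDerivAt_argmax hf hμ hlip hconc hstar
  have hgrad : gradient (Pmax f) = fun x' => pairFst n m (gradient f (pair x' (ystar x'))) :=
    funext fun x' => by
      rw [gradient_Pmax (hf.differentiable (by norm_num)) (fun z => (hY z).differentiableAt) hstar,
        gradx_eq (hf.differentiable (by norm_num))]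
  have hfd := (pairFst n m).hasFDerivAt.comp x
    ((hf.hasFDerivAt_fderiv_gradient _).comp x (hasFDerivAt_pair_argmax (hY x)))
  rw [hessP, hgrad]
  refine hfd.fderiv.trans ?_
  rw [Hmat, Hxx_eq hf, Hxy_eq hf]
  ext1 v
  simp only [ContinuousLinearMap.comp_apply, add_apply, neg_apply, map_add, map_neg, sub_eq_add_neg]

theorem norm_Hmat_sub_le {ρ : ℝ} (hf : ContDiff ℝ 2 f) (hμ : 0 < μ) (hℓ : 0 ≤ ℓ) (hρ : 0 ≤ ρ)
    (hlip : ∀ p q : WithLp 2 (En n × En m), ‖gradient f p - gradient f q‖ ≤ ℓ * ‖p - q‖)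
    (hxx : ∀ (x x' : En n) (y y' : En m),
      ‖Hxx f x y - Hxx f x' y'‖ ≤ ρ * ‖pair x y - pair x' y'‖)
    (hxy : ∀ (x x' : En n) (y y' : En m),
      ‖Hxy f x y - Hxy f x' y'‖ ≤ ρ * ‖pair x y - pair x' y'‖)
    (hyx : ∀ (x x' : En n) (y y' : En m),
      ‖Hyx f x y - Hyx f x' y'‖ ≤ ρ * ‖pair x y - pair x' y'‖)
    (hyy : ∀ (x x' : En n) (y y' : En m),
      ‖Hyy f x y - Hyy f x' y'‖ ≤ ρ * ‖pair x y - pair x' y'‖)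
    (hconc : ∀ x : En n, StrongConcaveOn Set.univ μ (fun y => f (pair x y)))
    (x : En n) (y z : En m) :
    ‖Hmat f x y - Hmat f x z‖ ≤ ρ * (1 + ℓ / μ) ^ 2 * ‖y - z‖ := by
  have hd : ‖pair x y - pair x z‖ = ‖y - z‖ := by rw [pair_sub_pair_right, norm_pairInr_apply]
  have hneg := inner_Hyy_apply_self_le hf hconc x
  refine (norm_schur_sub_le hμ hℓ (mul_nonneg hρ (norm_nonneg (pair x y - pair x z)))
    (isInvertible_of_inner_apply_self_le hμ (hneg y))
    (isInvertible_of_inner_apply_self_le hμ (hneg z))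
    (norm_inverse_le_of_inner_apply_self_le hμ (hneg y))
    (norm_inverse_le_of_inner_apply_self_le hμ (hneg z)) (norm_Hxy_le hf hℓ hlip x z)
    (norm_Hyx_le hf hℓ hlip x y) (hxx x x y z) (hxy x x y z) (hyx x x y z) (hyy x x y z)).trans_eq ?_
  rw [hd]; ring

end Blocks

/-- Gradient-ascent inner loop: with step size `η = 2/(ℓ+μ)`, iterates
`y_{k+1} = y_k + η ∇_y f(x, y_k)`, and `A = min{ε₁/ℓ, ε₂/L_H}` with `L_H = ρ(1+κ)²`,
if `N ≥ κ log(‖y₀ − y*(x)‖/A)` then `‖∇P(x) − ∇ₓf(x, y_N)‖ ≤ ε₁` and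
`‖∇²P(x) − H(x, y_N)‖ ≤ ε₂`. -/
theorem statement6 {n m : ℕ} (f : WithLp 2 (En n × En m) → ℝ) (ℓ μ ρ : ℝ)
    (hμ : 0 < μ) (hμℓ : μ < ℓ) (hρ : 0 < ρ)
    (hf : ContDiff ℝ 2 f)
    (hlip : ∀ p q : WithLp 2 (En n × En m), ‖gradient f p - gradient f q‖ ≤ ℓ * ‖p - q‖)
    (hxx : ∀ (x x' : En n) (y y' : En m),
      ‖Hxx f x y - Hxx f x' y'‖ ≤ ρ * ‖pair x y - pair x' y'‖)
    (hxy : ∀ (x x' : En n) (y y' : En m),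
      ‖Hxy f x y - Hxy f x' y'‖ ≤ ρ * ‖pair x y - pair x' y'‖)
    (hyx : ∀ (x x' : En n) (y y' : En m),
      ‖Hyx f x y - Hyx f x' y'‖ ≤ ρ * ‖pair x y - pair x' y'‖)
    (hyy : ∀ (x x' : En n) (y y' : En m),
      ‖Hyy f x y - Hyy f x' y'‖ ≤ ρ * ‖pair x y - pair x' y'‖)
    (hconc : ∀ x : En n, StrongConcaveOn Set.univ μ (fun y => f (pair x y)))
    (ystar : En n → En m)
    (hstar : ∀ (x : En n) (y : En m), f (pair x y) ≤ f (pair x (ystar x)))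
    (x : En n) (y₀ : En m) (yseq : ℕ → En m)
    (hy0 : yseq 0 = y₀)
    (hrec : ∀ k : ℕ, yseq (k + 1) = yseq k + (2 / (ℓ + μ)) • grady f x (yseq k))
    (ε₁ ε₂ : ℝ) (hε₁ : 0 < ε₁) (hε₂ : 0 < ε₂) (N : ℕ)
    (hN : (N : ℝ) ≥ ℓ / μ *
      Real.log (‖y₀ - ystar x‖ / min (ε₁ / ℓ) (ε₂ / (ρ * (1 + ℓ / μ) ^ 2)))) :
    ‖gradient (Pmax f) x - gradx f x (yseq N)‖ ≤ ε₁ ∧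
    ‖hessP (Pmax f) x - Hmat f x (yseq N)‖ ≤ ε₂ := by
  have hℓ : 0 < ℓ := hμ.trans hμℓ
  have hLH : 0 < ρ * (1 + ℓ / μ) ^ 2 := by positivity
  have hz : grady f x (ystar x) = 0 := grady_eq_zero_of_isMax (hstar x)
  have hrate : 0 ≤ (ℓ - μ) / (ℓ + μ) := div_nonneg (by linarith) (by linarith)
  have hgeom : ∀ k, ‖yseq k - ystar x‖ ≤ ((ℓ - μ) / (ℓ + μ)) ^ k * ‖y₀ - ystar x‖ := by
    intro k
    induction k with
    | zero => simp [hy0]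
    | succ k ih =>
      have hstep := norm_gradient_step_sub_le hf hμ hμℓ hlip hconc x (yseq k) (ystar x)
      rw [hz, smul_zero, add_zero, ← hrec] at hstep
      calc _ ≤ (ℓ - μ) / (ℓ + μ) * ‖yseq k - ystar x‖ := hstep
        _ ≤ (ℓ - μ) / (ℓ + μ) * (((ℓ - μ) / (ℓ + μ)) ^ k * ‖y₀ - ystar x‖) := by gcongr
        _ = _ := by ring
  have hdist : ‖ystar x - yseq N‖ ≤ min (ε₁ / ℓ) (ε₂ / (ρ * (1 + ℓ / μ) ^ 2)) := by
    rw [norm_sub_rev]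
    exact (hgeom N).trans (pow_mul_le_of_mul_log_le hμ hμℓ (norm_nonneg _)
      (lt_min (div_pos hε₁ hℓ) (div_pos hε₂ hLH)) hN)
  constructor
  · rw [gradient_Pmax (hf.differentiable (by norm_num))
      (fun z => (hasFDerivAt_argmax hf hμ hlip hconc hstar z).differentiableAt) hstar,
      gradx_eq (hf.differentiable (by norm_num)), gradx_eq (hf.differentiable (by norm_num)),
      ← map_sub]
    refine (norm_pairFst_apply_le _).trans ((hlip _ _).trans ?_)
    rw [pair_sub_pair_right, norm_pairInr_apply, ← le_div_iff₀' hℓ]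
    exact hdist.trans (min_le_left _ _)
  · rw [hessP_Pmax hf hμ hlip hconc hstar]
    refine (norm_Hmat_sub_le hf hμ hℓ.le hρ.le hlip hxx hxy hyx hyy hconc x _ _).trans ?_
    rw [← le_div_iff₀' hLH]
    exact hdist.trans (min_le_right _ _)
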